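/- Let Ω ⊂ ℝ² be a closed bounded rectangle, let H ∈ C³(Ω) be such that H_x and H_y never vanish on Ω, let a, b > 0, and let μ be a probability measure on ℝ that is absolutely continuous with respect to Lebesgue measure and satisfies ∫_ℝ |t|⁵ dμ(t) < ∞. Suppose H satisfies inequality (★) for μ (with n = 1). Let (u,v) be an interior point of Ω and set A = H_xx(u,v)/H_x(u,v)², B = H_xy(u,v)/(H_x(u,v)H_y(u,v)), C = H_yy(u,v)/H_y(u,v)², and D = (H_xx H_yy − H_xy²)/(H_x² H_y²) evaluated at (u,v). Then for all real numbers p, q with p + q + A − 2B + C < 0 one has (pC + pq + qA + D)/(A + p − 2B + C + q) ≥ p a² + q b². -/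

import Mathlib

open MeasureTheory Real Filter

noncomputable section

def Hx (H : ℝ × ℝ → ℝ) (z : ℝ × ℝ) : ℝ := fderiv ℝ H z (1, 0)
def Hy (H : ℝ × ℝ → ℝ) (z : ℝ × ℝ) : ℝ := fderiv ℝ H z (0, 1)
def Hxx (H : ℝ × ℝ → ℝ) (z : ℝ × ℝ) : ℝ := fderiv ℝ (Hx H) z (1, 0)
def Hxy (H : ℝ × ℝ → ℝ) (z : ℝ × ℝ) : ℝ := fderiv ℝ (Hx H) z (0, 1)
def Hyy (H : ℝ × ℝ → ℝ) (z : ℝ × ℝ) : ℝ := fderiv ℝ (Hy H) z (0, 1)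

/-- Inequality (★) in dimension `n = 1`. -/
def StarIneq1 (a b : ℝ) (Ω : Set (ℝ × ℝ)) (H : ℝ × ℝ → ℝ) (μ : Measure ℝ) : Prop :=
  ∀ f g : ℝ → ℝ, Measurable f → Measurable g →
    (∀ x y, (f x, g y) ∈ Ω) →
    H (∫ x, f x ∂μ, ∫ x, g x ∂μ) ≤
      ∫ x, essSup (fun y => H (f ((x - y) / a), g (y / b))) volume ∂μ

/-- `w + p / 2 * w ^ 2` near the origin, cut off to the low constant value `-η` for `δ < |w|`. -/
def trunc (p δ η w : ℝ) : ℝ := if |w| ≤ δ then w + p / 2 * w ^ 2 else -η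

lemma abs_trunc_le {p δ η : ℝ} (hp : |p| * δ ≤ 2) (hδη : 2 * δ ≤ η) (hη : 0 < η) (w : ℝ) :
    |trunc p δ η w| ≤ η := by
  unfold trunc
  split_ifs with h
  · have h1 : |w + p / 2 * w ^ 2| ≤ |w| + |p| / 2 * |w| ^ 2 := by
      refine (abs_add_le _ _).trans_eq ?_
      rw [abs_mul, abs_div, abs_pow]; norm_num
    have h0 := abs_nonneg w
    have h2 : |p| * |w| ≤ 2 := (mul_le_mul_of_nonneg_left h (abs_nonneg p)).trans hp
    nlinarith
  · rw [abs_neg, abs_of_pos hη]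

lemma abs_trunc_sub_le {p δ η : ℝ} (hδ : 0 < δ) (hη : 0 < η) (w : ℝ) :
    |trunc p δ η w - (w + p / 2 * w ^ 2)|
      ≤ (η / δ ^ 3 + 1 / δ ^ 2 + |p| / 2 / δ) * |w| ^ 3 := by
  unfold trunc
  split_ifs with h
  · simp only [sub_self, abs_zero]; positivity
  · push Not at h
    have hw : 0 < |w| := hδ.trans h
    have e1 : |-η - (w + p / 2 * w ^ 2)| ≤ η + |w| + |p| / 2 * |w| ^ 2 := by
      have h1 : |w + p / 2 * w ^ 2| ≤ |w| + |p| / 2 * |w| ^ 2 := by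
        refine (abs_add_le _ _).trans_eq ?_
        rw [abs_mul, abs_div, abs_pow]; norm_num
      have h2 := abs_sub (-η) (w + p / 2 * w ^ 2)
      rw [abs_neg, abs_of_pos hη] at h2
      linarith
    have r : 1 ≤ |w| / δ := (one_le_div hδ).2 h.le
    have r2 : 1 ≤ (|w| / δ) ^ 2 := one_le_pow₀ r
    have r3 : 1 ≤ (|w| / δ) ^ 3 := one_le_pow₀ r
    have r' : |p| / 2 * |w| ^ 2 ≤ |p| / 2 * |w| ^ 2 * (|w| / δ) :=
      le_mul_of_one_le_right (by positivity) r
    calc _ ≤ _ := e1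
      _ ≤ η * (|w| / δ) ^ 3 + |w| * (|w| / δ) ^ 2 + |p| / 2 * |w| ^ 2 * (|w| / δ) := by
        gcongr ?_ + ?_ + ?_
        · exact le_mul_of_one_le_right hη.le r3
        · exact le_mul_of_one_le_right hw.le r2
      _ = _ := by field_simp

lemma measurable_trunc (p δ η : ℝ) : Measurable (trunc p δ η) := by
  unfold trunc
  refine Measurable.ite (measurableSet_le (by fun_prop) (by fun_prop)) (by fun_prop) (by fun_prop)

/-- `h` has the second-order expansion `w + z + (A w² + 2 B w z + C z²) / 2` at the origin. -/
def HasQuadExpansion (h : ℝ → ℝ → ℝ) (A B C : ℝ) : Prop :=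
  ∀ θ > 0, ∃ r > 0, ∀ w z : ℝ, |w| ≤ r → |z| ≤ r →
    |h w z - (w + z) - (A * w ^ 2 + 2 * B * w * z + C * z ^ 2) / 2| ≤ θ * (w ^ 2 + z ^ 2)

lemma HasQuadExpansion.abs_sub_le {h : ℝ → ℝ → ℝ} {A B C : ℝ} (hT : HasQuadExpansion h A B C) :
    ∃ r > 0, ∃ M > 0, ∀ w z : ℝ, |w| ≤ r → |z| ≤ r →
      |h w z - (w + z)| ≤ M * (w ^ 2 + z ^ 2) := by
  obtain ⟨r, hr, H⟩ := hT 1 one_pos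
  refine ⟨r, hr, 1 + |A| + |B| + |C|, by positivity, fun w z hw hz => ?_⟩
  have h1 := H w z hw hz
  have hA : |A * w ^ 2| ≤ |A| * (w ^ 2 + z ^ 2) := by
    rw [abs_mul, abs_of_nonneg (sq_nonneg w)]
    gcongr; nlinarith
  have hC : |C * z ^ 2| ≤ |C| * (w ^ 2 + z ^ 2) := by
    rw [abs_mul, abs_of_nonneg (sq_nonneg z)]
    gcongr; nlinarith
  have hB : |2 * B * w * z| ≤ |B| * (w ^ 2 + z ^ 2) := by
    rw [show 2 * B * w * z = B * (2 * w * z) by ring, abs_mul]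
    gcongr
    rw [abs_le]; constructor <;> nlinarith [sq_nonneg (w + z), sq_nonneg (w - z)]
  have hpos : 0 ≤ w ^ 2 + z ^ 2 := by positivity
  have := mul_nonneg (abs_nonneg A) hpos
  have := mul_nonneg (abs_nonneg B) hpos
  have := mul_nonneg (abs_nonneg C) hpos
  rw [abs_le] at *
  constructor <;> nlinarith

lemma HasQuadExpansion.comp_quadratic {h : ℝ → ℝ → ℝ} {A B C : ℝ}
    (hT : HasQuadExpansion h A B C) (p q : ℝ) :
    HasQuadExpansion (fun w z => h (w + p / 2 * w ^ 2) (z + q / 2 * z ^ 2)) (A + p) B (C + q) := by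
  intro θ hθ
  obtain ⟨r, hr, H⟩ := hT (θ / 8) (by positivity)
  set k := 1 + |p| + |q| with hk
  set M := 1 + |A| + |B| + |C| with hM
  have hk1 : 1 ≤ k := by have := abs_nonneg p; have := abs_nonneg q; linarith
  have hM1 : 1 ≤ M := by
    have := abs_nonneg A; have := abs_nonneg B; have := abs_nonneg C; linarith
  have hpk : |p| ≤ k := by have := abs_nonneg q; linarith
  have hqk : |q| ≤ k := by have := abs_nonneg p; linarith
  refine ⟨min (r / 2) (min (1 / k) (θ / (8 * M * k))), by positivity, fun w z hw hz => ?_⟩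
  simp only [le_min_iff] at hw hz
  obtain ⟨hw1, hw2, hw3⟩ := hw
  obtain ⟨hz1, hz2, hz3⟩ := hz
  rw [le_div_iff₀ (by positivity)] at hw2 hz2 hw3 hz3
  -- write the substituted variables as `w (1 + s)` and `z (1 + t)`
  obtain ⟨s, hs⟩ : ∃ s, s = p / 2 * w := ⟨_, rfl⟩
  obtain ⟨t, ht⟩ : ∃ t, t = q / 2 * z := ⟨_, rfl⟩
  have hs' : |s| ≤ |w| * k / 2 := by
    rw [hs, abs_mul, abs_div, abs_two]; linarith [mul_le_mul_of_nonneg_right hpk (abs_nonneg w)]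
  have ht' : |t| ≤ |z| * k / 2 := by
    rw [ht, abs_mul, abs_div, abs_two]; linarith [mul_le_mul_of_nonneg_right hqk (abs_nonneg z)]
  have ew : w + p / 2 * w ^ 2 = w * (1 + s) := by rw [hs]; ring
  have ez : z + q / 2 * z ^ 2 = z * (1 + t) := by rw [ht]; ring
  have hs1 : |s| ≤ 1 / 2 := by linarith
  have ht1 : |t| ≤ 1 / 2 := by linarith
  have hsM : |s| * M ≤ θ / 16 := by
    linarith [mul_le_mul_of_nonneg_right hs' (zero_le_one.trans hM1)]
  have htM : |t| * M ≤ θ / 16 := by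
    linarith [mul_le_mul_of_nonneg_right ht' (zero_le_one.trans hM1)]
  have bs : |1 + s| ≤ 2 := by have := abs_add_le 1 s; rw [abs_one] at this; linarith
  have bt : |1 + t| ≤ 2 := by have := abs_add_le 1 t; rw [abs_one] at this; linarith
  have h1 := H (w * (1 + s)) (z * (1 + t))
    (by rw [abs_mul]; linarith [mul_le_mul_of_nonneg_left bs (abs_nonneg w)])
    (by rw [abs_mul]; linarith [mul_le_mul_of_nonneg_left bt (abs_nonneg z)])
  have hsq : (w * (1 + s)) ^ 2 + (z * (1 + t)) ^ 2 ≤ 4 * (w ^ 2 + z ^ 2) := by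
    have a1 : (1 + s) ^ 2 ≤ 4 := by
      rw [← sq_abs]; exact (pow_le_pow_left₀ (abs_nonneg _) bs 2).trans (by norm_num)
    have a2 : (1 + t) ^ 2 ≤ 4 := by
      rw [← sq_abs]; exact (pow_le_pow_left₀ (abs_nonneg _) bt 2).trans (by norm_num)
    rw [mul_pow, mul_pow]
    linarith [mul_le_mul_of_nonneg_left a1 (sq_nonneg w),
      mul_le_mul_of_nonneg_left a2 (sq_nonneg z)]
  have hpos : 0 ≤ w ^ 2 + z ^ 2 := by positivity
  have e1 : |A * (w ^ 2 * (s * (2 + s)))| ≤ |A| * ((w ^ 2 + z ^ 2) * (4 * (|s| + |t|))) := by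
    rw [abs_mul, abs_mul, abs_mul, abs_of_nonneg (sq_nonneg w)]
    gcongr ?_ * (?_ * ?_)
    · linarith [sq_nonneg w, sq_nonneg z]
    · have i1 : |2 + s| ≤ 4 := by have := abs_add_le 2 s; rw [abs_two] at this; linarith
      have i2 := mul_le_mul_of_nonneg_left i1 (abs_nonneg s)
      linarith [abs_nonneg s, abs_nonneg t]
  have e2 : |C * (z ^ 2 * (t * (2 + t)))| ≤ |C| * ((w ^ 2 + z ^ 2) * (4 * (|s| + |t|))) := by
    rw [abs_mul, abs_mul, abs_mul, abs_of_nonneg (sq_nonneg z)]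
    gcongr ?_ * (?_ * ?_)
    · linarith [sq_nonneg w, sq_nonneg z]
    · have i1 : |2 + t| ≤ 4 := by have := abs_add_le 2 t; rw [abs_two] at this; linarith
      have i2 := mul_le_mul_of_nonneg_left i1 (abs_nonneg t)
      linarith [abs_nonneg s, abs_nonneg t]
  have e3 : |B * (2 * w * z * (s + t + s * t))| ≤ |B| * ((w ^ 2 + z ^ 2) * (4 * (|s| + |t|))) := by
    rw [abs_mul, abs_mul]
    gcongr ?_ * (?_ * ?_)
    · rw [abs_le]; constructor <;> linarith [sq_nonneg (w + z), sq_nonneg (w - z), add_sq w z, sub_sq w z]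
    · have i1 := abs_add_le (s + t) (s * t)
      have i2 := abs_add_le s t
      have i3 : |s * t| ≤ 1 * |t| := by
        rw [abs_mul]; gcongr; linarith
      linarith [abs_nonneg s, abs_nonneg t]
  have e4 : (|A| + |B| + |C|) * ((w ^ 2 + z ^ 2) * (4 * (|s| + |t|)))
      ≤ (w ^ 2 + z ^ 2) * (θ / 2) := by
    have i1 : (|A| + |B| + |C|) * (|s| + |t|) ≤ M * (|s| + |t|) := by
      gcongr; linarith
    have i2 : (|A| + |B| + |C|) * (4 * (|s| + |t|)) ≤ θ / 2 := by linarith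
    calc _ = (w ^ 2 + z ^ 2) * ((|A| + |B| + |C|) * (4 * (|s| + |t|))) := by ring
      _ ≤ _ := by gcongr
  simp only [ew, ez]
  have key : h (w * (1 + s)) (z * (1 + t)) - (w + z) -
      ((A + p) * w ^ 2 + 2 * B * w * z + (C + q) * z ^ 2) / 2
      = (h (w * (1 + s)) (z * (1 + t)) - (w * (1 + s) + z * (1 + t)) -
        (A * (w * (1 + s)) ^ 2 + 2 * B * (w * (1 + s)) * (z * (1 + t)) +
          C * (z * (1 + t)) ^ 2) / 2)
        + (A * (w ^ 2 * (s * (2 + s))) + B * (2 * w * z * (s + t + s * t)) +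
          C * (z ^ 2 * (t * (2 + t)))) / 2 := by
    have : p * w ^ 2 = 2 * w * s := by rw [hs]; ring
    have : q * z ^ 2 = 2 * z * t := by rw [ht]; ring
    linarith
  rw [key]
  have h1' := h1.trans (mul_le_mul_of_nonneg_left hsq (by positivity))
  obtain ⟨l1, u1⟩ := abs_le.1 h1'
  obtain ⟨l2, u2⟩ := abs_le.1 e1
  obtain ⟨l3, u3⟩ := abs_le.1 e2
  obtain ⟨l4, u4⟩ := abs_le.1 e3
  have hθpos : 0 ≤ θ * (w ^ 2 + z ^ 2) := by positivity
  rw [abs_le]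
  constructor <;> linarith

lemma HasQuadExpansion.le_on_line {h : ℝ → ℝ → ℝ} {A B C : ℝ} (hT : HasQuadExpansion h A B C)
    (hN : A - 2 * B + C < 0) {θ : ℝ} (hθ : 0 < θ) :
    ∃ r > 0, ∀ w z : ℝ, |w| ≤ r → |z| ≤ r →
      h w z ≤ (w + z) + ((A * C - B ^ 2) / (A - 2 * B + C) + θ) / 2 * (w + z) ^ 2 := by
  obtain ⟨N, hNdef⟩ : ∃ N, N = -(A - 2 * B + C) := ⟨_, rfl⟩
  have hN0 : 0 < N := by linarith
  obtain ⟨c, hc⟩ : ∃ c, c = (B - A) / N := ⟨_, rfl⟩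
  set k := 2 * c ^ 2 + 2 * (1 - c) ^ 2 + 1 with hk
  have hk0 : 0 < k := by positivity
  obtain ⟨r, hr, H⟩ := hT (min (N / 8) (θ / (2 * k))) (by positivity)
  refine ⟨r, hr, fun w z hw hz => ?_⟩
  have h1 := (abs_le.1 (H w z hw hz)).2
  set τ := min (N / 8) (θ / (2 * k)) with hτ
  have hτ0 : 0 < τ := by positivity
  have hτ1 : τ ≤ N / 8 := min_le_left _ _
  have hτ2 : τ * k ≤ θ / 2 := by
    have : τ ≤ θ / (2 * k) := min_le_right _ _
    rw [le_div_iff₀ (by positivity)] at this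
    linarith
  have hcN : c * N = B - A := by rw [hc]; field_simp
  obtain ⟨y, hy⟩ : ∃ y, y = z - c * (w + z) := ⟨_, rfl⟩
  obtain ⟨K, hK⟩ : ∃ K, K = (A * C - B ^ 2) / (A - 2 * B + C) := ⟨_, rfl⟩
  have hKN : K * N = B ^ 2 - A * C := by
    have : A - 2 * B + C ≠ 0 := hN.ne
    rw [hK, hNdef, mul_neg, div_mul_cancel₀ _ this]; ring
  have hKA : K = A + N * c ^ 2 := by
    have : K * N = (A + N * c ^ 2) * N := by
      rw [hKN, show (A + N * c ^ 2) * N = A * N + (c * N) ^ 2 by ring, hcN, hNdef]; ring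
    exact mul_right_cancel₀ hN0.ne' this
  have hquad : A * w ^ 2 + 2 * B * w * z + C * z ^ 2 = K * (w + z) ^ 2 - N * y ^ 2 := by
    have hB : B = A + c * N := by linarith
    have hC : C = -N - A + 2 * B := by linarith
    rw [hKA, hy, hC, hB]; ring
  have hwz : w ^ 2 + z ^ 2 ≤ 4 * y ^ 2 + k * (w + z) ^ 2 := by
    have hz' : z = y + c * (w + z) := by linarith
    have hw' : w = (1 - c) * (w + z) - y := by linarith
    have h1 : z ^ 2 ≤ 2 * y ^ 2 + 2 * c ^ 2 * (w + z) ^ 2 := by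
      calc z ^ 2 = (y + c * (w + z)) ^ 2 := by rw [← hz']
        _ ≤ _ := by nlinarith [sq_nonneg (y - c * (w + z))]
    have h2 : w ^ 2 ≤ 2 * y ^ 2 + 2 * (1 - c) ^ 2 * (w + z) ^ 2 := by
      calc w ^ 2 = ((1 - c) * (w + z) - y) ^ 2 := by rw [← hw']
        _ ≤ _ := by nlinarith [sq_nonneg (y + (1 - c) * (w + z))]
    have h3 := sq_nonneg (w + z)
    rw [hk]; linarith
  rw [← hK]
  have := mul_le_mul_of_nonneg_left hwz hτ0.le
  have := mul_le_mul_of_nonneg_right hτ1 (sq_nonneg y)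
  have := mul_le_mul_of_nonneg_right hτ2 (sq_nonneg (w + z))
  have := mul_nonneg hN0.le (sq_nonneg y)
  linarith

lemma trunc_le_two_mul {p δ η : ℝ} (hp : |p| * δ ≤ 2) (hδ : 0 < δ) (hη : 0 < η) (w : ℝ) :
    trunc p δ η w ≤ 2 * δ := by
  have h := abs_trunc_le hp le_rfl (by positivity : 0 < 2 * δ) w
  unfold trunc at h ⊢
  split_ifs with hw
  · rw [if_pos hw] at h
    exact (le_abs_self _).trans h
  · linarith

lemma HasQuadExpansion.exists_trunc_le {h : ℝ → ℝ → ℝ} {A B C : ℝ}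
    (hT : HasQuadExpansion h A B C) {p q : ℝ} (hN : A + p - 2 * B + (C + q) < 0)
    {R θ : ℝ} (hR : 0 < R) (hθ : 0 < θ) (Mb : ℝ) :
    ∃ δ > 0, ∃ η > 0, η ≤ R ∧ |p| * δ ≤ 2 ∧ |q| * δ ≤ 2 ∧ 2 * δ ≤ η ∧ ∃ L ≥ 0, ∀ w z : ℝ,
      h (trunc p δ η w) (trunc q δ η z) ≤ Mb →
      h (trunc p δ η w) (trunc q δ η z) ≤ (w + z) +
        (((A + p) * (C + q) - B ^ 2) / (A + p - 2 * B + (C + q)) + θ) / 2 * (w + z) ^ 2 +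
        L * |w + z| ^ 3 := by
  obtain ⟨r₀, hr₀, M, hM, hcrude⟩ := hT.abs_sub_le
  obtain ⟨r₁, hr₁, hline⟩ := (hT.comp_quadratic p q).le_on_line hN hθ
  set E := (((A + p) * (C + q) - B ^ 2) / (A + p - 2 * B + (C + q)) + θ) / 2
  obtain ⟨η, hη, hηR, hηr, hηM⟩ : ∃ η > 0, η ≤ R ∧ η ≤ r₀ ∧ η * (8 * M) ≤ 1 := by
    refine ⟨min R (min r₀ (1 / (8 * M))), by positivity, min_le_left _ _,
      (min_le_right _ _).trans (min_le_left _ _), ?_⟩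
    rw [← le_div_iff₀ (by positivity)]
    exact (min_le_right _ _).trans (min_le_right _ _)
  obtain ⟨δ, hδ, hδr, hδη, hδp, hδq⟩ :
      ∃ δ > 0, δ ≤ r₁ ∧ δ ≤ η / 8 ∧ |p| * δ ≤ 2 ∧ |q| * δ ≤ 2 := by
    have hpq : 0 < |p| + |q| + 1 := by positivity
    refine ⟨min r₁ (min (η / 8) (1 / (|p| + |q| + 1))), by positivity, min_le_left _ _,
      (min_le_right _ _).trans (min_le_left _ _), ?_, ?_⟩
    all_goals
      have h1 : min r₁ (min (η / 8) (1 / (|p| + |q| + 1))) ≤ 1 / (|p| + |q| + 1) :=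
        (min_le_right _ _).trans (min_le_right _ _)
      have h0 : 0 < min r₁ (min (η / 8) (1 / (|p| + |q| + 1))) := by positivity
      rw [le_div_iff₀ hpq] at h1
      nlinarith [abs_nonneg p, abs_nonneg q]
  obtain ⟨κ, hκ, hκη, hκE⟩ : ∃ κ > 0, κ ≤ η / 4 ∧ |E| * κ ≤ 1 := by
    refine ⟨min (η / 4) (1 / (1 + |E|)), by positivity, min_le_left _ _, ?_⟩
    have h1 : min (η / 4) (1 / (1 + |E|)) ≤ 1 / (1 + |E|) := min_le_right _ _
    have h0 : 0 < min (η / 4) (1 / (1 + |E|)) := by positivity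
    rw [le_div_iff₀ (by positivity)] at h1
    nlinarith [abs_nonneg E]
  have hL : 0 ≤ |Mb| / κ ^ 3 + 1 / κ ^ 2 + |E| / κ := by positivity
  refine ⟨δ, hδ, η, hη, hηR, hδp, hδq, by linarith, _, hL, fun w z hMb => ?_⟩
  have hE : -(|E| * |w + z| ^ 2) ≤ E * (w + z) ^ 2 := by
    rw [sq_abs, neg_le_iff_add_nonneg]
    have := neg_abs_le E
    nlinarith [sq_nonneg (w + z)]
  have hneg := neg_abs_le (w + z)
  have hX0 := abs_nonneg (w + z)
  by_cases hwz : |w| ≤ δ ∧ |z| ≤ δ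
  · have h1 := hline w z (hwz.1.trans hδr) (hwz.2.trans hδr)
    rw [trunc, trunc, if_pos hwz.1, if_pos hwz.2]
    have : 0 ≤ (|Mb| / κ ^ 3 + 1 / κ ^ 2 + |E| / κ) * |w + z| ^ 3 := by positivity
    linarith
  rcases le_or_gt |w + z| κ with hX | hX
  · have hw := abs_trunc_le hδp (by linarith) hη w
    have hz := abs_trunc_le hδq (by linarith) hη z
    have hw2 := trunc_le_two_mul hδp hδ hη w
    have hz2 := trunc_le_two_mul hδq hδ hη z
    have hsum : trunc p δ η w + trunc q δ η z ≤ -(3 / 4 * η) := by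
      rw [not_and_or] at hwz
      rcases hwz with hw' | hz'
      · have : trunc p δ η w = -η := if_neg hw'
        linarith
      · have : trunc q δ η z = -η := if_neg hz'
        linarith
    have h1 := (abs_le.1 (hcrude _ _ (hw.trans hηr) (hz.trans hηr))).2
    have hw3 : trunc p δ η w ^ 2 ≤ η ^ 2 := by rw [← sq_abs]; gcongr
    have hz3 : trunc q δ η z ^ 2 ≤ η ^ 2 := by rw [← sq_abs (trunc q δ η z)]; gcongr
    have h2 : M * (trunc p δ η w ^ 2 + trunc q δ η z ^ 2) ≤ η / 4 := by
      calc _ ≤ M * (η ^ 2 + η ^ 2) := by gcongr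
        _ = η * (8 * M) * (η / 4) := by ring
        _ ≤ 1 * (η / 4) := by gcongr
        _ = _ := one_mul _
    have h3 : |E| * |w + z| ^ 2 ≤ κ := by
      calc _ ≤ |E| * κ ^ 2 := by gcongr
        _ = |E| * κ * κ := by ring
        _ ≤ 1 * κ := by gcongr
        _ = κ := one_mul κ
    have : 0 ≤ (|Mb| / κ ^ 3 + 1 / κ ^ 2 + |E| / κ) * |w + z| ^ 3 := by positivity
    linarith
  · have r1 : 1 ≤ |w + z| / κ := (one_le_div hκ).2 hX.le
    have h1 : |Mb| ≤ |Mb| * (|w + z| / κ) ^ 3 :=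
      le_mul_of_one_le_right (abs_nonneg _) (one_le_pow₀ r1)
    have h2 : |w + z| ≤ |w + z| * (|w + z| / κ) ^ 2 :=
      le_mul_of_one_le_right (abs_nonneg _) (one_le_pow₀ r1)
    have h3 : |E| * |w + z| ^ 2 ≤ |E| * |w + z| ^ 2 * (|w + z| / κ) :=
      le_mul_of_one_le_right (by positivity) r1
    have h4 : (|Mb| / κ ^ 3 + 1 / κ ^ 2 + |E| / κ) * |w + z| ^ 3 =
        |Mb| * (|w + z| / κ) ^ 3 + |w + z| * (|w + z| / κ) ^ 2 +
          |E| * |w + z| ^ 2 * (|w + z| / κ) := by field_simp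
    have := le_abs_self Mb
    linarith

lemma HasQuadExpansion.lower_bound {h : ℝ → ℝ → ℝ} {A B C : ℝ}
    (hT : HasQuadExpansion h A B C) (α β : ℝ) {k : ℝ} (hk : 0 ≤ k) :
    ∃ ε₀ > 0, ∃ L ≥ 0, ∀ ε w z : ℝ, |ε| ≤ ε₀ →
      |w - α * ε ^ 2| ≤ k * |ε| ^ 3 → |z - β * ε ^ 2| ≤ k * |ε| ^ 3 →
      (α + β) * ε ^ 2 - L * |ε| ^ 3 ≤ h w z := by
  obtain ⟨r, hr, M, hM, hcrude⟩ := hT.abs_sub_le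
  set j := |α| + |β| + k + 1 with hj
  have hj0 : 0 < j := by positivity
  refine ⟨min 1 (r / j), by positivity, 2 * k + 2 * M * j ^ 2, by positivity,
    fun ε w z hε hw hz => ?_⟩
  have hε1 : |ε| ≤ 1 := hε.trans (min_le_left _ _)
  have hε2 : j * |ε| ≤ r := by
    have := hε.trans (min_le_right _ _)
    rwa [le_div_iff₀ hj0, mul_comm] at this
  have he : 0 ≤ |ε| := abs_nonneg ε
  have he3 : |ε| ^ 3 ≤ |ε| ^ 2 := pow_le_pow_of_le_one he hε1 (by norm_num)
  have he2 : |ε| ^ 2 ≤ |ε| := by simpa using pow_le_pow_of_le_one he hε1 (by norm_num : 1 ≤ 2)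
  have he4 : |ε| ^ 4 ≤ |ε| ^ 3 := pow_le_pow_of_le_one he hε1 (by norm_num)
  have size : ∀ x γ : ℝ, |γ| ≤ |α| + |β| → |x - γ * ε ^ 2| ≤ k * |ε| ^ 3 →
      |x| ≤ j * |ε| ^ 2 := by
    intro x γ hγ hx
    have h1 : |x| ≤ |x - γ * ε ^ 2| + |γ * ε ^ 2| := by
      have := abs_add_le (x - γ * ε ^ 2) (γ * ε ^ 2)
      rwa [sub_add_cancel] at this
    rw [abs_mul, abs_pow] at h1
    have h2 : k * |ε| ^ 3 ≤ k * |ε| ^ 2 := by gcongr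
    have h3 : |γ| * |ε| ^ 2 ≤ (|α| + |β|) * |ε| ^ 2 := by gcongr
    rw [hj]
    nlinarith [sq_nonneg |ε|]
  have hw' := size w α (by linarith [abs_nonneg β]) hw
  have hz' := size z β (by linarith [abs_nonneg α]) hz
  have hjr : j * |ε| ^ 2 ≤ r := (by gcongr : j * |ε| ^ 2 ≤ j * |ε|).trans hε2
  have h1 := (abs_le.1 (hcrude w z (hw'.trans hjr) (hz'.trans hjr))).1
  have h2 : M * (w ^ 2 + z ^ 2) ≤ 2 * M * j ^ 2 * |ε| ^ 3 := by
    rw [← sq_abs w, ← sq_abs z]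
    calc M * (|w| ^ 2 + |z| ^ 2) ≤ M * ((j * |ε| ^ 2) ^ 2 + (j * |ε| ^ 2) ^ 2) := by gcongr
      _ = 2 * M * j ^ 2 * |ε| ^ 4 := by ring
      _ ≤ _ := by gcongr
  have := (abs_le.1 hw).1
  have := (abs_le.1 hz).1
  linarith

lemma nonpos_of_forall_le_mul {c k ε₀ : ℝ} (hε₀ : 0 < ε₀)
    (h : ∀ t, 0 < t → t ≤ ε₀ → c ≤ k * t) : c ≤ 0 := by
  by_contra! hc
  have hk : 0 < |k| + 1 := by positivity
  have ht : 0 < min ε₀ (c / (2 * (|k| + 1))) := by positivity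
  have h1 := h _ ht (min_le_left _ _)
  have h2 : min ε₀ (c / (2 * (|k| + 1))) ≤ c / (2 * (|k| + 1)) := min_le_right _ _
  rw [le_div_iff₀ (by positivity)] at h2
  nlinarith [le_abs_self k]

lemma coeff_of_forall_small {c₁ c₂ L ε₀ : ℝ} (hε₀ : 0 < ε₀) (hL : 0 ≤ L)
    (h : ∀ ε : ℝ, |ε| ≤ ε₀ → 0 ≤ c₁ * ε + c₂ * ε ^ 2 + L * |ε| ^ 3) : c₁ = 0 ∧ 0 ≤ c₂ := by
  have hc₁ : |c₁| ≤ 0 := by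
    refine nonpos_of_forall_le_mul (k := |c₂| + L) (lt_min hε₀ one_pos) fun t ht ht' => ?_
    have ht1 : t ≤ 1 := ht'.trans (min_le_right _ _)
    have hte : t ≤ ε₀ := ht'.trans (min_le_left _ _)
    have hpos := h t (by rwa [abs_of_pos ht])
    have hneg := h (-t) (by rwa [abs_neg, abs_of_pos ht])
    rw [abs_neg] at hneg
    rw [abs_of_pos ht] at hpos hneg
    have e1 : t ^ 3 ≤ t ^ 2 := pow_le_pow_of_le_one ht.le ht1 (by norm_num)
    have e2 : L * t ^ 3 ≤ L * t ^ 2 := by gcongr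
    have e3 : c₂ * t ^ 2 ≤ |c₂| * t ^ 2 := by gcongr; exact le_abs_self _
    have key : |c₁| * t ≤ (|c₂| + L) * t * t := by
      rcases abs_cases c₁ with ⟨e, _⟩ | ⟨e, _⟩ <;> rw [e] <;> nlinarith
    exact le_of_mul_le_mul_right key ht
  have hc₁' : c₁ = 0 := abs_nonpos_iff.1 hc₁
  refine ⟨hc₁', ?_⟩
  have : -c₂ ≤ 0 := by
    refine nonpos_of_forall_le_mul (k := L) hε₀ fun t ht ht' => ?_
    have hpos := h t (by rwa [abs_of_pos ht])
    rw [abs_of_pos ht, hc₁'] at hpos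
    have : -c₂ * t ^ 2 ≤ L * t * t ^ 2 := by nlinarith
    exact le_of_mul_le_mul_right this (by positivity)
  linarith

lemma ContDiffAt.taylor_two {E : Type*} [NormedAddCommGroup E] [NormedSpace ℝ E] {f : E → ℝ}
    {x : E} (hf : ContDiffAt ℝ 2 f x) {θ : ℝ} (hθ : 0 < θ) :
    ∃ r > 0, ∀ v : E, ‖v‖ ≤ r →
      |f (x + v) - f x - fderiv ℝ f x v - fderiv ℝ (fderiv ℝ f) x v v / 2| ≤ θ * ‖v‖ ^ 2 := by
  set L := fderiv ℝ (fderiv ℝ f) x with hL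
  have hsymm : IsSymmSndFDerivAt ℝ f x := hf.isSymmSndFDerivAt (by simp)
  have hd1 : DifferentiableAt ℝ (fderiv ℝ f) x :=
    (hf.fderiv_right (m := 1) (by norm_num)).differentiableAt (by norm_num)
  have hev : ∀ᶠ y in nhds x, DifferentiableAt ℝ f y := by
    filter_upwards [hf.eventually (by simp)] with y hy
    exact hy.differentiableAt (by norm_num)
  have hlo : ∀ᶠ y in nhds x, ‖fderiv ℝ f y - fderiv ℝ f x - L (y - x)‖ ≤ θ * ‖y - x‖ :=
    hd1.hasFDerivAt.isLittleO.def hθ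
  obtain ⟨r, hr, hball⟩ := Metric.eventually_nhds_iff_ball.1 (hev.and hlo)
  refine ⟨r / 2, by positivity, fun v hv => ?_⟩
  have hder : ∀ y ∈ Metric.closedBall (0 : E) ‖v‖,
      HasFDerivWithinAt (fun y => f (x + y) - fderiv ℝ f x y - L y y / 2)
        (fderiv ℝ f (x + y) - fderiv ℝ f x - L y) (Metric.closedBall (0 : E) ‖v‖) y := by
    intro y hy
    have hy' : x + y ∈ Metric.ball x r := by
      simp only [mem_closedBall_zero_iff] at hy
      simp only [Metric.mem_ball, dist_self_add_left]
      linarith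
    have h1 : HasFDerivAt (fun y => f (x + y)) (fderiv ℝ f (x + y)) y :=
      (hball _ hy').1.hasFDerivAt.comp y ((hasFDerivAt_id y).const_add x)
    have h2 : HasFDerivAt (fun y => L y y) (L y + L.flip y) y := by
      have := (L.hasFDerivAt (x := y)).clm_apply (hasFDerivAt_id y)
      refine this.congr_fderiv ?_
      ext z
      simp
    simp only [div_eq_mul_inv]
    refine HasFDerivAt.hasFDerivWithinAt ?_
    refine ((h1.sub (fderiv ℝ f x).hasFDerivAt).sub (h2.mul_const 2⁻¹)).congr_fderiv ?_
    ext z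
    have : L z y = L y z := hsymm z y
    simp [this]
    ring
  have hbound : ∀ y ∈ Metric.closedBall (0 : E) ‖v‖,
      ‖fderiv ℝ f (x + y) - fderiv ℝ f x - L y‖ ≤ θ * ‖v‖ := by
    intro y hy
    simp only [mem_closedBall_zero_iff] at hy
    have hy' : x + y ∈ Metric.ball x r := by
      simp only [Metric.mem_ball, dist_self_add_left]
      linarith
    have := (hball _ hy').2
    rw [add_sub_cancel_left] at this
    exact this.trans (by gcongr)
  have := (convex_closedBall (0 : E) ‖v‖).norm_image_sub_le_of_norm_hasFDerivWithin_le
    hder hbound (x := 0) (y := v) (by simp) (by simp)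
  simp only [add_zero, map_zero, sub_zero, zero_div, Real.norm_eq_abs] at this
  calc _ = |f (x + v) - fderiv ℝ f x v - L v v / 2 - f x| := by congr 1; ring
    _ ≤ _ := by rw [sq, ← mul_assoc]; simpa using this

lemma hasQuadExpansion_of_contDiffAt {H : ℝ × ℝ → ℝ} {u v : ℝ} (hH : ContDiffAt ℝ 2 H (u, v))
    (hx : Hx H (u, v) ≠ 0) (hy : Hy H (u, v) ≠ 0) :
    HasQuadExpansion
      (fun w z => H (u + w / Hx H (u, v), v + z / Hy H (u, v)) - H (u, v))
      (Hxx H (u, v) / Hx H (u, v) ^ 2) (Hxy H (u, v) / (Hx H (u, v) * Hy H (u, v)))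
      (Hyy H (u, v) / Hy H (u, v) ^ 2) := by
  intro θ hθ
  have hsymm : IsSymmSndFDerivAt ℝ H (u, v) := hH.isSymmSndFDerivAt (by simp)
  have hd1 : DifferentiableAt ℝ (fderiv ℝ H) (u, v) :=
    (hH.fderiv_right (m := 1) (by norm_num)).differentiableAt (by norm_num)
  set L := fderiv ℝ (fderiv ℝ H) (u, v) with hL
  have happ : ∀ e d : ℝ × ℝ, fderiv ℝ (fun z => fderiv ℝ H z e) (u, v) d = L d e := by
    intro e d
    have := hd1.hasFDerivAt.clm_apply (hasFDerivAt_const e (u, v))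
    rw [this.fderiv]
    simp [hL]
  have hxx : Hxx H (u, v) = L (1, 0) (1, 0) := happ _ _
  have hxy : Hxy H (u, v) = L (0, 1) (1, 0) := happ _ _
  have hyy : Hyy H (u, v) = L (0, 1) (0, 1) := happ _ _
  have hyx : L (1, 0) (0, 1) = L (0, 1) (1, 0) := hsymm _ _
  set cx := Hx H (u, v) with hcx
  set cy := Hy H (u, v) with hcy
  have hk : 0 < 1 / cx ^ 2 + 1 / cy ^ 2 := by positivity
  set k := 1 / cx ^ 2 + 1 / cy ^ 2
  obtain ⟨r, hr, ht⟩ := hH.taylor_two (θ := θ / k) (by positivity)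
  have hcx0 : 0 < |cx| := abs_pos.2 hx
  have hcy0 : 0 < |cy| := abs_pos.2 hy
  refine ⟨min (r * |cx|) (r * |cy|), by positivity, fun w z hw hz => ?_⟩
  have hdecomp : (w / cx, z / cy) = (w / cx) • ((1, 0) : ℝ × ℝ) + (z / cy) • ((0, 1) : ℝ × ℝ) := by
    simp
  have hnorm : ‖(w / cx, z / cy)‖ ≤ r := by
    refine norm_prod_le_iff.2 ⟨?_, ?_⟩
    · simp only [norm_div, Real.norm_eq_abs]
      exact (div_le_iff₀ hcx0).2 (hw.trans (min_le_left _ _))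
    · simp only [norm_div, Real.norm_eq_abs]
      exact (div_le_iff₀ hcy0).2 (hz.trans (min_le_right _ _))
  have h1 := ht _ hnorm
  have hsq : ‖(w / cx, z / cy)‖ ^ 2 ≤ k * (w ^ 2 + z ^ 2) := by
    have hk1 : 1 / cx ^ 2 ≤ k := le_add_of_nonneg_right (by positivity)
    have hk2 : 1 / cy ^ 2 ≤ k := le_add_of_nonneg_left (by positivity)
    rcases max_cases ‖w / cx‖ ‖z / cy‖ with ⟨e, _⟩ | ⟨e, _⟩ <;>
      rw [Prod.norm_mk, e, Real.norm_eq_abs, sq_abs, div_pow]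
    · calc w ^ 2 / cx ^ 2 = 1 / cx ^ 2 * w ^ 2 := by ring
        _ ≤ k * (w ^ 2 + z ^ 2) := by gcongr; nlinarith
    · calc z ^ 2 / cy ^ 2 = 1 / cy ^ 2 * z ^ 2 := by ring
        _ ≤ k * (w ^ 2 + z ^ 2) := by gcongr; nlinarith
  have hfirst : fderiv ℝ H (u, v) (w / cx, z / cy) = w + z := by
    have e1 : fderiv ℝ H (u, v) (1, 0) = cx := rfl
    have e2 : fderiv ℝ H (u, v) (0, 1) = cy := rfl
    rw [hdecomp, map_add, map_smul, map_smul, e1, e2, smul_eq_mul, smul_eq_mul]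
    field_simp
  have hsecond : L (w / cx, z / cy) (w / cx, z / cy) =
      Hxx H (u, v) / cx ^ 2 * w ^ 2 + 2 * (Hxy H (u, v) / (cx * cy)) * w * z +
        Hyy H (u, v) / cy ^ 2 * z ^ 2 := by
    rw [hdecomp]
    simp only [map_add, map_smul, add_apply, smul_apply,
      smul_eq_mul, hyx, hxx, hxy, hyy]
    field_simp
    ring
  rw [hfirst, hsecond, Prod.mk_add_mk] at h1
  refine h1.trans ((mul_le_mul_of_nonneg_left hsq (by positivity)).trans_eq ?_)
  field_simp

lemma essSup_le_of_forall_le {α : Type*} [MeasurableSpace α] {μ : Measure α} [NeZero μ]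
    {f : α → ℝ} {m c : ℝ} (hm : ∀ y, m ≤ f y) (hc : ∀ y, f y ≤ c) : essSup f μ ≤ c := by
  refine limsup_le_of_le ?_ (Eventually.of_forall hc)
  exact (isBoundedUnder_of ⟨m, hm⟩ : IsBoundedUnder (· ≥ ·) (ae μ) f).isCoboundedUnder_le

lemma le_essSup_of_forall_le {α : Type*} [MeasurableSpace α] {μ : Measure α} [NeZero μ]
    {f : α → ℝ} {m c : ℝ} (hm : ∀ y, m ≤ f y) (hc : ∀ y, f y ≤ c) : m ≤ essSup f μ :=
  le_limsup_of_frequently_le (Eventually.of_forall hm).frequently (isBoundedUnder_of ⟨c, hc⟩)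

lemma measurable_essSup {α β : Type*} [MeasurableSpace α] [MeasurableSpace β] {μ : Measure β}
    [NeZero μ] [SFinite μ] {F : α × β → ℝ} (hF : Measurable F) {m c : ℝ} (hm : ∀ x, m ≤ F x)
    (hc : ∀ x, F x ≤ c) : Measurable fun x => essSup (fun y => F (x, y)) μ := by
  refine measurable_of_Iic fun t => ?_
  have : (fun x => essSup (fun y => F (x, y)) μ) ⁻¹' Set.Iic t =
      (fun x => μ (Prod.mk x ⁻¹' {z | t < F z})) ⁻¹' {0} := by
    ext x
    simp only [Set.mem_preimage, Set.mem_Iic, Set.mem_singleton_iff]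
    constructor
    · intro h
      have hae : ∀ᵐ y ∂μ, F (x, y) ≤ essSup (fun y => F (x, y)) μ :=
        ae_le_essSup (isBoundedUnder_of ⟨c, fun y => hc (x, y)⟩)
      have hae' : ∀ᵐ y ∂μ, F (x, y) ≤ t := hae.mono fun y hy => hy.trans h
      simpa [ae_iff] using hae'
    · intro h
      have hae : ∀ᵐ y ∂μ, F (x, y) ≤ t := by simpa [ae_iff] using h
      refine limsup_le_of_le ?_ hae
      exact (isBoundedUnder_of ⟨m, fun y => hm (x, y)⟩ :
        IsBoundedUnder (· ≥ ·) (ae μ) fun y => F (x, y)).isCoboundedUnder_le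
  rw [this]
  exact measurable_measure_prodMk_left (measurableSet_lt measurable_const hF)
    (measurableSet_singleton 0)

lemma integrable_abs_sub_pow {μ : Measure ℝ} [IsFiniteMeasure μ] {n k : ℕ} (hn : n ≠ 0)
    (hmom : Integrable (fun t => |t| ^ n) μ) (hk : k ≤ n) (hk0 : k ≠ 0) (c : ℝ) :
    Integrable (fun t => |t - c| ^ k) μ := by
  have h1 : MemLp (fun t : ℝ => t) n μ := by
    have := integrable_norm_rpow_iff (μ := μ) (f := fun t : ℝ => t) (p := n)
      (by fun_prop) (by exact_mod_cast hn) (by simp)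
    simp only [ENNReal.toReal_natCast, Real.rpow_natCast, Real.norm_eq_abs] at this
    exact this.1 hmom
  have h2 : MemLp (fun t : ℝ => t - c) k μ :=
    (h1.mono_exponent (by exact_mod_cast hk)).sub (memLp_const c)
  have := h2.integrable_norm_rpow (by exact_mod_cast hk0) (by simp)
  simpa using this

lemma integral_sq_sub_pos {μ : Measure ℝ} [IsProbabilityMeasure μ] (hac : μ ≪ volume) {c : ℝ}
    (hint : Integrable (fun t => (t - c) ^ 2) μ) : 0 < ∫ t, (t - c) ^ 2 ∂μ := by
  rw [integral_pos_iff_support_of_nonneg (fun t => sq_nonneg _) hint]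
  have hsupp : Function.support (fun t : ℝ => (t - c) ^ 2) = {c}ᶜ := by
    ext t
    simp [sub_eq_zero]
  have h0 : μ {c} = 0 := hac (by simp)
  rw [hsupp, prob_compl_eq_one_sub (measurableSet_singleton c), h0]
  simp

lemma abs_integral_trunc_sub_le {μ : Measure ℝ} [IsProbabilityMeasure μ]
    (h1 : Integrable (fun t => t) μ) (h2 : ∀ c, Integrable (fun t => |t - c| ^ 2) μ)
    (h3 : ∀ c, Integrable (fun t => |t - c| ^ 3) μ)
    {p δ η : ℝ} (hp : |p| * δ ≤ 2) (hδη : 2 * δ ≤ η) (hδ : 0 < δ) (hη : 0 < η) (m s : ℝ)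
    (hm : m = ∫ t, t ∂μ) :
    |∫ t, trunc p δ η (s * (t - m)) ∂μ - p / 2 * s ^ 2 * ∫ t, (t - m) ^ 2 ∂μ|
      ≤ (η / δ ^ 3 + 1 / δ ^ 2 + |p| / 2 / δ) * (∫ t, |t - m| ^ 3 ∂μ) * |s| ^ 3 := by
  have hsq : Integrable (fun t => (t - m) ^ 2) μ := by simpa using h2 m
  have hT : Integrable (fun t => trunc p δ η (s * (t - m))) μ := by
    refine Integrable.of_bound
      ((measurable_trunc p δ η).comp (by fun_prop)).aestronglyMeasurable η (ae_of_all _ fun t => ?_)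
    exact abs_trunc_le hp hδη hη _
  have hlin : Integrable (fun t => s * (t - m)) μ := (h1.sub (integrable_const m)).const_mul s
  have hquad : Integrable (fun t => p / 2 * s ^ 2 * (t - m) ^ 2) μ := hsq.const_mul _
  have hmean : ∫ t, s * (t - m) ∂μ = 0 := by
    rw [integral_const_mul, integral_sub h1 (integrable_const m), ← hm]
    simp
  have key : ∫ t, trunc p δ η (s * (t - m)) ∂μ - p / 2 * s ^ 2 * ∫ t, (t - m) ^ 2 ∂μ =
      ∫ t, (trunc p δ η (s * (t - m)) - (s * (t - m) + p / 2 * s ^ 2 * (t - m) ^ 2)) ∂μ := by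
    have hlq : Integrable (fun t => s * (t - m) + p / 2 * s ^ 2 * (t - m) ^ 2) μ := hlin.add hquad
    rw [integral_sub hT hlq, integral_add hlin hquad, hmean, integral_const_mul,
      zero_add]
  rw [key, ← Real.norm_eq_abs]
  refine (norm_integral_le_of_norm_le (((h3 m).const_mul
    ((η / δ ^ 3 + 1 / δ ^ 2 + |p| / 2 / δ) * |s| ^ 3))) (ae_of_all _ fun t => ?_)).trans_eq ?_
  · have := abs_trunc_sub_le (p := p) hδ hη (s * (t - m))
    rw [abs_mul, mul_pow, mul_pow] at this
    rw [Real.norm_eq_abs]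
    calc _ = |trunc p δ η (s * (t - m)) - (s * (t - m) + p / 2 * (s ^ 2 * (t - m) ^ 2))| := by
          congr 2; ring
      _ ≤ _ := this
      _ = _ := by ring
  · rw [integral_const_mul]; ring

lemma integral_essSup_le {α β : Type*} [MeasurableSpace α] [MeasurableSpace β] {μ : Measure α}
    [IsFiniteMeasure μ] {ν : Measure β} [NeZero ν] [SFinite ν] {Φ : α × β → ℝ}
    (hΦ : Measurable Φ) {m c : ℝ} (hm : ∀ x, m ≤ Φ x) (hc : ∀ x, Φ x ≤ c) {r : α → ℝ}
    (hr : Integrable r μ) (hle : ∀ x y, Φ (x, y) ≤ r x) :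
    ∫ x, essSup (fun y => Φ (x, y)) ν ∂μ ≤ ∫ x, r x ∂μ := by
  have hint : Integrable (fun x => essSup (fun y => Φ (x, y)) ν) μ :=
    Integrable.of_mem_Icc m c (measurable_essSup hΦ hm hc).aemeasurable (ae_of_all _ fun x =>
      ⟨le_essSup_of_forall_le (fun _ => hm _) (fun _ => hc _),
        essSup_le_of_forall_le (fun _ => hm _) (fun _ => hc _)⟩)
  exact integral_mono hint hr fun x => essSup_le_of_forall_le (fun _ => hm _) (hle x)

lemma measurable_comp_of_continuousOn {α X : Type*} [MeasurableSpace α] [TopologicalSpace X]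
    [MeasurableSpace X] [OpensMeasurableSpace X] {Ω : Set X} {H : X → ℝ}
    (hcont : ContinuousOn H Ω) (hΩ : MeasurableSet Ω) {φ : α → X} (hφ : Measurable φ)
    (hmem : ∀ x, φ x ∈ Ω) : Measurable fun x => H (φ x) := by
  classical
  have hpw : Measurable (Ω.piecewise H fun _ => 0) :=
    hcont.measurable_piecewise continuousOn_const hΩ
  have heq : (fun x => H (φ x)) = (Ω.piecewise H fun _ => 0) ∘ φ :=
    funext fun x => (Set.piecewise_eq_of_mem _ _ _ (hmem x)).symm
  rw [heq]
  exact hpw.comp hφ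

lemma StarIneq1.apply_bound {a b : ℝ} {Ω : Set (ℝ × ℝ)} {H : ℝ × ℝ → ℝ} {μ : Measure ℝ}
    [IsProbabilityMeasure μ] (hstar : StarIneq1 a b Ω H μ) (hΩ : IsCompact Ω)
    (hcont : ContinuousOn H Ω) (ha : a ≠ 0) (hb : b ≠ 0)
    (h1 : Integrable (fun t => t) μ) (h2 : ∀ c, Integrable (fun t => |t - c| ^ 2) μ)
    (h3 : ∀ c, Integrable (fun t => |t - c| ^ 3) μ)
    {F G : ℝ → ℝ} (hF : Measurable F) (hG : Measurable G) (hFG : ∀ w z, (F w, G z) ∈ Ω)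
    {c E L : ℝ} (hbd : ∀ w z, H (F w, G z) ≤ c + (w + z) + E * (w + z) ^ 2 + L * |w + z| ^ 3)
    (m ε : ℝ) :
    H (∫ t, F (ε * a * (t - m)) ∂μ, ∫ t, G (ε * b * (t - m)) ∂μ) ≤
      c + (∫ t, t ∂μ - (a + b) * m) * ε + E * (∫ t, (t - (a + b) * m) ^ 2 ∂μ) * ε ^ 2 +
        L * (∫ t, |t - (a + b) * m| ^ 3 ∂μ) * |ε| ^ 3 := by
  obtain ⟨M, hM⟩ := hΩ.exists_bound_of_continuousOn hcont
  simp only [Real.norm_eq_abs, abs_le] at hM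
  set n := (a + b) * m with hn
  have hsub : ∀ x y : ℝ, ε * a * ((x - y) / a - m) + ε * b * (y / b - m) = ε * (x - n) := by
    intro x y
    rw [hn]; field_simp; ring
  have hφ : Measurable fun z : ℝ × ℝ =>
      (F (ε * a * ((z.1 - z.2) / a - m)), G (ε * b * (z.2 / b - m))) :=
    (hF.comp (by fun_prop)).prodMk (hG.comp (by fun_prop))
  have hΦ := measurable_comp_of_continuousOn hcont hΩ.measurableSet hφ fun _ => hFG _ _
  have hle : ∀ x y, H (F (ε * a * ((x - y) / a - m)), G (ε * b * (y / b - m))) ≤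
      c + ε * (x - n) + E * ε ^ 2 * (x - n) ^ 2 + L * |ε| ^ 3 * |x - n| ^ 3 := by
    intro x y
    refine (hbd _ _).trans_eq ?_
    rw [hsub, abs_mul]; ring
  have h2n : Integrable (fun t => (t - n) ^ 2) μ := by simpa using h2 n
  have i0 : Integrable (fun x => ε * (x - n)) μ := (h1.sub (integrable_const n)).const_mul ε
  have i1 : Integrable (fun x => c + ε * (x - n)) μ := (integrable_const c).add i0
  have i2 : Integrable (fun x => E * ε ^ 2 * (x - n) ^ 2) μ := h2n.const_mul _
  have i3 : Integrable (fun x => L * |ε| ^ 3 * |x - n| ^ 3) μ := (h3 n).const_mul _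
  have i12 : Integrable (fun x => c + ε * (x - n) + E * ε ^ 2 * (x - n) ^ 2) μ := i1.add i2
  have i123 : Integrable (fun x => c + ε * (x - n) + E * ε ^ 2 * (x - n) ^ 2 +
      L * |ε| ^ 3 * |x - n| ^ 3) μ := i12.add i3
  have hval : ∫ x, (c + ε * (x - n) + E * ε ^ 2 * (x - n) ^ 2 + L * |ε| ^ 3 * |x - n| ^ 3) ∂μ =
      c + (∫ t, t ∂μ - n) * ε + E * (∫ t, (t - n) ^ 2 ∂μ) * ε ^ 2 +
        L * (∫ t, |t - n| ^ 3 ∂μ) * |ε| ^ 3 := by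
    rw [integral_add i12 i3, integral_add i1 i2, integral_add (integrable_const c) i0,
      integral_const_mul, integral_const_mul, integral_const_mul,
      integral_sub h1 (integrable_const n), integral_const, integral_const,
      probReal_univ, one_smul, one_smul]
    ring
  refine (hstar (fun s => F (ε * a * (s - m))) (fun t => G (ε * b * (t - m)))
    (hF.comp (by fun_prop)) (hG.comp (by fun_prop)) (fun _ _ => hFG _ _)).trans ?_
  exact (integral_essSup_le hΦ (fun _ => (hM _ (hFG _ _)).1) (fun _ => (hM _ (hFG _ _)).2)
    i123 hle).trans_eq hval

/-- the quadratic-form inequality (main-form) derived from inequality (★). -/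
theorem stmt2 (P Q : ℝ × ℝ) (hPQ1 : P.1 < Q.1) (hPQ2 : P.2 < Q.2)
    (H : ℝ × ℝ → ℝ) (hH : ContDiffOn ℝ 3 H (Set.Icc P Q))
    (hHx : ∀ z ∈ interior (Set.Icc P Q), Hx H z ≠ 0)
    (hHy : ∀ z ∈ interior (Set.Icc P Q), Hy H z ≠ 0)
    (a b : ℝ) (ha : 0 < a) (hb : 0 < b)
    (μ : Measure ℝ) (hprob : IsProbabilityMeasure μ) (hac : μ ≪ volume)
    (hmom : Integrable (fun t => |t| ^ 5) μ)
    (hstar : StarIneq1 a b (Set.Icc P Q) H μ)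
    (u v : ℝ) (huv : (u, v) ∈ interior (Set.Icc P Q))
    (A B C D : ℝ)
    (hA : A = Hxx H (u, v) / (Hx H (u, v)) ^ 2)
    (hB : B = Hxy H (u, v) / (Hx H (u, v) * Hy H (u, v)))
    (hC : C = Hyy H (u, v) / (Hy H (u, v)) ^ 2)
    (hD : D = (Hxx H (u, v) * Hyy H (u, v) - (Hxy H (u, v)) ^ 2)
      / ((Hx H (u, v)) ^ 2 * (Hy H (u, v)) ^ 2)) :
    ∀ p q : ℝ, p + q + A - 2 * B + C < 0 →
      p * a ^ 2 + q * b ^ 2 ≤ (p * C + p * q + q * A + D) / (A + p - 2 * B + C + q) := by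
  intro p q hpq
  have hx := hHx _ huv
  have hy := hHy _ huv
  have hmem : Set.Icc P Q ∈ nhds (u, v) := mem_interior_iff_mem_nhds.1 huv
  have hT : HasQuadExpansion
      (fun w z => H (u + w / Hx H (u, v), v + z / Hy H (u, v)) - H (u, v)) A B C := by
    rw [hA, hB, hC]
    exact hasQuadExpansion_of_contDiffAt ((hH.contDiffAt hmem).of_le (by norm_num)) hx hy
  have hK : (p * C + p * q + q * A + D) / (A + p - 2 * B + C + q) =
      ((A + p) * (C + q) - B ^ 2) / (A + p - 2 * B + (C + q)) := by
    have hDeq : D = A * C - B ^ 2 := by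
      rw [hD, hA, hB, hC]; field_simp
    rw [hDeq]
    congr 1 <;> ring
  rw [hK]
  refine le_of_forall_pos_le_add fun θ hθ => ?_
  set cx := Hx H (u, v)
  set cy := Hy H (u, v)
  have hcx0 : 0 < |cx| := abs_pos.2 hx
  have hcy0 : 0 < |cy| := abs_pos.2 hy
  obtain ⟨ρ, hρ, hball⟩ := Metric.nhds_basis_closedBall.mem_iff.1 hmem
  have hbox : ∀ s t : ℝ, |s| ≤ min (ρ * |cx|) (ρ * |cy|) → |t| ≤ min (ρ * |cx|) (ρ * |cy|) →
      (u + s / cx, v + t / cy) ∈ Set.Icc P Q := by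
    intro s t hs ht
    refine hball ?_
    rw [mem_closedBall_iff_norm, Prod.mk_sub_mk, add_sub_cancel_left, add_sub_cancel_left,
      norm_prod_le_iff]
    simp only [norm_div, Real.norm_eq_abs]
    exact ⟨(div_le_iff₀ hcx0).2 (hs.trans (min_le_left _ _)),
      (div_le_iff₀ hcy0).2 (ht.trans (min_le_right _ _))⟩
  obtain ⟨M, hM⟩ := isCompact_Icc.exists_bound_of_continuousOn hH.continuousOn
  obtain ⟨δ, hδ, η, hη, hηR, hpδ, hqδ, hδη, L, hL, hbd⟩ := hT.exists_trunc_le (p := p) (q := q)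
    (by linarith) (by positivity : 0 < min (ρ * |cx|) (ρ * |cy|)) hθ (M - H (u, v))
  set K := ((A + p) * (C + q) - B ^ 2) / (A + p - 2 * B + (C + q))
  have hin : ∀ w z, (u + trunc p δ η w / cx, v + trunc q δ η z / cy) ∈ Set.Icc P Q :=
    fun w z => hbox _ _ ((abs_trunc_le hpδ hδη hη w).trans hηR)
      ((abs_trunc_le hqδ hδη hη z).trans hηR)
  have hbd' : ∀ w z, H (u + trunc p δ η w / cx, v + trunc q δ η z / cy) ≤
      H (u, v) + (w + z) + (K + θ) / 2 * (w + z) ^ 2 + L * |w + z| ^ 3 := by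
    intro w z
    have hle := (le_abs_self _).trans (hM _ (hin w z))
    have := hbd w z (by linarith)
    linarith
  have h1 : Integrable (fun t => t) μ := by
    have := integrable_abs_sub_pow (by norm_num) hmom (by norm_num : 1 ≤ 5) one_ne_zero 0
    simp only [sub_zero, pow_one] at this
    exact (integrable_norm_iff (by fun_prop)).1 this
  have h2 := integrable_abs_sub_pow (by norm_num) hmom (by norm_num : 2 ≤ 5) two_ne_zero
  have h3 := integrable_abs_sub_pow (by norm_num) hmom (by norm_num : 3 ≤ 5) three_ne_zero
  obtain ⟨m, hm⟩ : ∃ m, m = ∫ t, t ∂μ := ⟨_, rfl⟩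
  set V := ∫ t, (t - m) ^ 2 ∂μ with hV
  have hVpos : 0 < V := integral_sq_sub_pos hac (by simpa using h2 m)
  have hM3 : 0 ≤ ∫ t, |t - m| ^ 3 ∂μ := integral_nonneg fun t => by positivity
  have hM3' : 0 ≤ ∫ t, |t - (a + b) * m| ^ 3 ∂μ := integral_nonneg fun t => by positivity
  set M₃ := ∫ t, |t - m| ^ 3 ∂μ
  set kp := (η / δ ^ 3 + 1 / δ ^ 2 + |p| / 2 / δ) * M₃ * a ^ 3
  set kq := (η / δ ^ 3 + 1 / δ ^ 2 + |q| / 2 / δ) * M₃ * b ^ 3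
  have hkp : 0 ≤ kp := by positivity
  have hkq : 0 ≤ kq := by positivity
  obtain ⟨ε₀, hε₀, L', hL', hlow⟩ := hT.lower_bound (p / 2 * a ^ 2 * V) (q / 2 * b ^ 2 * V)
    (add_nonneg hkp hkq)
  have hTint : ∀ r s : ℝ, |r| * δ ≤ 2 → Integrable (fun t => trunc r δ η (s * (t - m))) μ := by
    intro r s hr
    refine Integrable.of_bound
      ((measurable_trunc r δ η).comp (by fun_prop)).aestronglyMeasurable η (ae_of_all _ fun t => ?_)
    exact abs_trunc_le hr hδη hη _
  have hmean : ∀ x r s c : ℝ, |r| * δ ≤ 2 →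
      ∫ t, (x + trunc r δ η (s * (t - m)) / c) ∂μ =
        x + (∫ t, trunc r δ η (s * (t - m)) ∂μ) / c := by
    intro x r s c hr
    rw [integral_add (integrable_const x) ((hTint r s hr).div_const c), integral_div]
    simp
  have hfinal : ∀ ε : ℝ, |ε| ≤ ε₀ →
      0 ≤ (m - (a + b) * m) * ε +
        ((K + θ) / 2 * (∫ t, (t - (a + b) * m) ^ 2 ∂μ) -
          (p / 2 * a ^ 2 * V + q / 2 * b ^ 2 * V)) * ε ^ 2 +
        (L * (∫ t, |t - (a + b) * m| ^ 3 ∂μ) + L') * |ε| ^ 3 := by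
    intro ε hε
    have hup := hstar.apply_bound isCompact_Icc hH.continuousOn ha.ne' hb.ne' h1 h2 h3
      (F := fun w => u + trunc p δ η w / cx) (G := fun z => v + trunc q δ η z / cy)
      (((measurable_trunc p δ η).div_const cx).const_add u)
      (((measurable_trunc q δ η).div_const cy).const_add v) hin hbd' m ε
    rw [hmean _ _ _ _ hpδ, hmean _ _ _ _ hqδ, ← hm] at hup
    have hep := abs_integral_trunc_sub_le h1 h2 h3 hpδ hδη hδ hη m (ε * a) hm
    have heq := abs_integral_trunc_sub_le h1 h2 h3 hqδ hδη hδ hη m (ε * b) hm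
    rw [abs_mul, abs_of_pos ha] at hep
    rw [abs_mul, abs_of_pos hb] at heq
    have hcub : 0 ≤ |ε| ^ 3 := by positivity
    have hlo := hlow ε
      (∫ t, trunc p δ η (ε * a * (t - m)) ∂μ) (∫ t, trunc q δ η (ε * b * (t - m)) ∂μ) hε
      (by
        calc _ = |∫ t, trunc p δ η (ε * a * (t - m)) ∂μ - p / 2 * (ε * a) ^ 2 * V| := by
              congr 2; ring
          _ ≤ _ := hep
          _ = kp * |ε| ^ 3 := by ring
          _ ≤ _ := by gcongr; linarith)
      (by
        calc _ = |∫ t, trunc q δ η (ε * b * (t - m)) ∂μ - q / 2 * (ε * b) ^ 2 * V| := by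
              congr 2; ring
          _ ≤ _ := heq
          _ = kq * |ε| ^ 3 := by ring
          _ ≤ _ := by gcongr; linarith)
    linarith
  obtain ⟨hc1, hc2⟩ := coeff_of_forall_small hε₀ (by positivity) hfinal
  rw [← sub_eq_zero.1 hc1, ← hV] at hc2
  have : (p * a ^ 2 + q * b ^ 2) * V ≤ (K + θ) * V := by linarith
  exact le_of_mul_le_mul_right this hVpos

end
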